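/- Let n ≥ 2, set n_* = n(n+1)/2, and let P̄ ∈ ℝ^{n×n} be a symmetric positive-definite matrix. Then there exist a constant r₀ > 0, unit vectors ν_1, …, ν_{n_*} ∈ S^{n−1} ⊂ ℝ^n, and smooth functions a_1, …, a_{n_*} defined on the set U = { P ∈ ℝ^{n×n} symmetric positive definite : |P − P̄| < r₀ } such that P = Σ_{k=1}^{n_*} a_k(P)^2 ν_k ⊗ ν_k for every P ∈ U. -/

import Mathlib

attribute [local instance] Matrix.normedAddCommGroup Matrix.normedSpace

section NashDecomposition

variable {ι : Type*}

/-- For symmetric `F`, the sum over ordered pairs `i ≤ j` counted twice is the full sum plus the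
diagonal. -/
lemma two_mul_sum_le_eq [Fintype ι] [LinearOrder ι] (F : ι → ι → ℝ) (hF : ∀ i j, F i j = F j i) :
    2 * ∑ p : {p : ι × ι // p.1 ≤ p.2}, F p.1.1 p.1.2 = ∑ i, ∑ j, F i j + ∑ i, F i i := by
  have h1 : ∑ p : {p : ι × ι // p.1 ≤ p.2}, F p.1.1 p.1.2 =
      ∑ i, ∑ j, if i ≤ j then F i j else 0 := by
    rw [← Finset.sum_subtype (Finset.univ.filter fun p : ι × ι => p.1 ≤ p.2) (by simp)
      (fun p => F p.1 p.2), Finset.sum_filter, Fintype.sum_prod_type]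
  have h2 : ∑ i, ∑ j, (if i ≤ j then F i j else 0) = ∑ i, ∑ j, if j ≤ i then F i j else 0 := by
    rw [Finset.sum_comm]
    simp only [hF]
  have h3 : ∑ i, F i i = ∑ i, ∑ j, if i = j then F i j else 0 := by simp
  rw [two_mul, h1]
  nth_rewrite 2 [h2]
  rw [h3]
  simp only [← Finset.sum_add_distrib]
  refine Finset.sum_congr rfl fun i _ => Finset.sum_congr rfl fun j _ => ?_
  rcases lt_trichotomy i j with h | h | h
  · simp [h.le, h.not_ge, h.ne]
  · simp [h]
  · simp [h.le, h.not_ge, h.ne']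

/-- The coefficient of `(e i + e j) ⊗ (e i + e j)` in the expansion of a symmetric matrix. -/
noncomputable def pairCoeff [Fintype ι] [DecidableEq ι] (i j : ι) : Matrix ι ι ℝ →ₗ[ℝ] ℝ where
  toFun M := if i = j then (2 * M i i - ∑ k, M i k) / 4 else M i j
  map_add' M N := by
    split_ifs
    · simp only [Matrix.add_apply, Finset.sum_add_distrib]; ring
    · simp
  map_smul' c M := by
    split_ifs
    · simp only [Matrix.smul_apply, smul_eq_mul, ← Finset.mul_sum, RingHom.id_apply]; ring
    · simp

lemma pairCoeff_apply [Fintype ι] [DecidableEq ι] (i j : ι) (M : Matrix ι ι ℝ) :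
    pairCoeff i j M = if i = j then (2 * M i i - ∑ k, M i k) / 4 else M i j := rfl

/-- The vector `e i + e j`. -/
def pairVec [DecidableEq ι] (i j : ι) : ι → ℝ := Pi.single i 1 + Pi.single j 1

lemma pairVec_ne_zero [DecidableEq ι] (i j : ι) : pairVec i j ≠ 0 := by
  intro h
  have := congrFun h i
  by_cases hij : i = j <;> simp [pairVec, hij] at this

lemma sum_pairCoeff_smul_vecMulVec [Fintype ι] [LinearOrder ι] {M : Matrix ι ι ℝ} (hM : M.IsSymm) :
    ∑ p : {p : ι × ι // p.1 ≤ p.2}, pairCoeff p.1.1 p.1.2 M •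
      Matrix.vecMulVec (pairVec p.1.1 p.1.2) (pairVec p.1.1 p.1.2) = M := by
  ext a b
  have hsymm : ∀ i j, M i j = M j i := fun i j => hM.apply j i
  have key := two_mul_sum_le_eq
    (fun i j => pairCoeff i j M * (pairVec i j a * pairVec i j b)) (by
      intro i j
      by_cases h : i = j
      · rw [h]
      · rw [pairCoeff_apply, pairCoeff_apply, if_neg h, if_neg (Ne.symm h), hsymm i j]
        simp only [pairVec, Pi.add_apply]
        ring)
  have hsplit : ∀ i j, pairCoeff i j M * (pairVec i j a * pairVec i j b) =
      M i j * (pairVec i j a * pairVec i j b) +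
        if i = j then ((2 * M i i - ∑ k, M i k) / 4 - M i i) * (pairVec i i a * pairVec i i b)
        else 0 := by
    intro i j
    rw [pairCoeff_apply]
    split_ifs with h
    · subst h; ring
    · ring
  simp only [hsplit, Finset.sum_add_distrib, Finset.sum_ite_eq, Finset.mem_univ, if_true] at key
  simp only [Matrix.sum_apply, Matrix.smul_apply, Matrix.vecMulVec_apply, smul_eq_mul, hsplit,
    Finset.sum_add_distrib]
  have hcol : ∑ i, M i b = ∑ i, M b i := Finset.sum_congr rfl fun i _ => hsymm i b
  have hab := hsymm a b
  simp only [pairVec, Pi.add_apply, Pi.single_apply, mul_add, Finset.sum_add_distrib,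
    mul_ite, mul_one, mul_zero, Finset.sum_ite_eq, Finset.sum_ite_irrel,
    Finset.sum_const_zero,
    Finset.mem_univ, if_true] at key ⊢
  by_cases h : a = b
  · subst h
    simp at key ⊢
    linarith
  · simp [h] at key ⊢
    linarith

/-- The matrix `∑_{i ≤ j} (e i + e j) ⊗ (e i + e j)`. -/
def pairGram (ι : Type*) [Fintype ι] [DecidableEq ι] : Matrix ι ι ℝ :=
  Matrix.of fun i j => if i = j then (Fintype.card ι + 3 : ℝ) else 1

lemma pairCoeff_pairGram [Fintype ι] [DecidableEq ι] (i j : ι) : pairCoeff i j (pairGram ι) = 1 := by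
  rw [pairCoeff_apply]
  split_ifs with h
  · have : ∀ k, pairGram ι i k = (if i = k then (Fintype.card ι + 2 : ℝ) else 0) + 1 := by
      intro k
      simp only [pairGram, Matrix.of_apply]
      split_ifs <;> ring
    simp only [this, Finset.sum_add_distrib, Finset.sum_ite_eq, Finset.mem_univ, if_true]
    simp
    ring
  · simp [pairGram, h]

lemma pairGram_posDef [Fintype ι] [DecidableEq ι] : (pairGram ι).PosDef := by
  have : pairGram ι = (Fintype.card ι + 2 : ℝ) • (1 : Matrix ι ι ℝ) +
      Matrix.vecMulVec (fun _ => 1) (star fun _ => 1) := by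
    ext i j
    simp only [pairGram, Matrix.of_apply, Matrix.add_apply, Matrix.smul_apply, Matrix.one_apply,
      Matrix.vecMulVec_apply, Pi.star_apply, star_one, smul_eq_mul]
    split_ifs <;> ring
  rw [this]
  exact (Matrix.PosDef.one.smul (by positivity)).add_posSemidef
    (Matrix.posSemidef_vecMulVec_self_star _)

open scoped MatrixOrder in
/-- Any two real positive definite matrices are congruent. -/
lemma Matrix.PosDef.exists_isUnit_mul_mul_transpose [Fintype ι] [DecidableEq ι] {P G : Matrix ι ι ℝ}
    (hP : P.PosDef) (hG : G.PosDef) : ∃ A : Matrix ι ι ℝ, IsUnit A ∧ P = A * G * A.transpose := by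
  obtain ⟨B, hB, rfl⟩ :=
    CStarAlgebra.isStrictlyPositive_iff_eq_star_mul_self.mp hP.isStrictlyPositive
  obtain ⟨C, hC, rfl⟩ :=
    CStarAlgebra.isStrictlyPositive_iff_eq_star_mul_self.mp hG.isStrictlyPositive
  lift C to (Matrix ι ι ℝ)ˣ using hC
  refine ⟨star B * star (↑C⁻¹ : Matrix ι ι ℝ), hB.star.mul (Units.isUnit _).star, ?_⟩
  have hT : (star B * star (↑C⁻¹ : Matrix ι ι ℝ)).transpose = (↑C⁻¹ : Matrix ι ι ℝ) * B := by
    rw [← Matrix.conjTranspose_eq_transpose_of_trivial, ← Matrix.star_eq_conjTranspose,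
      star_mul, star_star, star_star]
  have hC : star (↑C⁻¹ : Matrix ι ι ℝ) * star (C : Matrix ι ι ℝ) = 1 := by
    rw [← star_mul, Units.mul_inv, star_one]
  rw [hT]
  calc star B * B = star B * (star (↑C⁻¹ : Matrix ι ι ℝ) * star (C : Matrix ι ι ℝ)) *
        ((C : Matrix ι ι ℝ) * ↑C⁻¹) * B := by rw [hC, Units.mul_inv, mul_one, mul_one]
    _ = _ := by simp only [mul_assoc]

lemma Matrix.mul_vecMulVec_mul_transpose [Fintype ι] (A : Matrix ι ι ℝ) (v : ι → ℝ) :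
    A * Matrix.vecMulVec v v * A.transpose = Matrix.vecMulVec (A.mulVec v) (A.mulVec v) := by
  rw [Matrix.mul_vecMulVec, Matrix.vecMulVec_mul, Matrix.vecMul_transpose]

end NashDecomposition

lemma card_pairs_le (n : ℕ) :
    Fintype.card {p : Fin n × Fin n // p.1 ≤ p.2} = n * (n + 1) / 2 := by
  rw [← Fintype.card_congr Sym2.sortEquiv, Sym2.card, Fintype.card_fin, Nat.choose_two_right,
    Nat.add_sub_cancel, mul_comm]

/-- Nash's matrix decomposition lemma: any symmetric positive definite matrix in a
small neighborhood of a reference symmetric positive definite matrix `Pbar` can be written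
as a sum of `n(n+1)/2` squares times rank-one matrices `ν_k ⊗ ν_k` with smooth coefficients. -/
theorem stmt_5 (n : ℕ) (hn : 2 ≤ n)
    (Pbar : Matrix (Fin n) (Fin n) ℝ) (hPbar : Pbar.PosDef) :
    ∃ r₀ : ℝ, 0 < r₀ ∧
      ∃ (ν : Fin (n * (n + 1) / 2) → (Fin n → ℝ))
        (a : Fin (n * (n + 1) / 2) → Matrix (Fin n) (Fin n) ℝ → ℝ),
        (∀ k, ∑ i, (ν k i) ^ 2 = 1) ∧
        (∀ k, ContDiffOn ℝ (⊤ : ℕ∞) (a k)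
          {P : Matrix (Fin n) (Fin n) ℝ | P.PosDef ∧ ‖P - Pbar‖ < r₀}) ∧
        (∀ P : Matrix (Fin n) (Fin n) ℝ, P.PosDef → ‖P - Pbar‖ < r₀ →
          P = ∑ k, (a k P) ^ 2 • Matrix.vecMulVec (ν k) (ν k)) := by
  obtain ⟨A, hA, hPA⟩ := hPbar.exists_isUnit_mul_mul_transpose (pairGram_posDef (ι := Fin n))
  have hAdet : IsUnit A.det := (Matrix.isUnit_iff_isUnit_det A).mp hA
  have hAT : IsUnit A.transpose.det := by rwa [Matrix.det_transpose]
  let e : Fin (n * (n + 1) / 2) ≃ {p : Fin n × Fin n // p.1 ≤ p.2} :=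
    (Fintype.equivFinOfCardEq (card_pairs_le n)).symm
  let w : Fin (n * (n + 1) / 2) → Fin n → ℝ :=
    fun k => A.mulVec (pairVec (e k).1.1 (e k).1.2)
  let T : Matrix (Fin n) (Fin n) ℝ →ₗ[ℝ] Matrix (Fin n) (Fin n) ℝ :=
    LinearMap.mulLeft ℝ A⁻¹ ∘ₗ LinearMap.mulRight ℝ A.transpose⁻¹
  have hT : ∀ P, T P = A⁻¹ * (P * A.transpose⁻¹) := fun P => rfl
  let c : Fin (n * (n + 1) / 2) → Matrix (Fin n) (Fin n) ℝ →L[ℝ] ℝ :=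
    fun k => LinearMap.toContinuousLinearMap (pairCoeff (e k).1.1 (e k).1.2 ∘ₗ T)
  have hc : ∀ k P, c k P = pairCoeff (e k).1.1 (e k).1.2 (T P) := fun k P => rfl
  have hbar : ∀ k, c k Pbar = 1 := by
    intro k
    have : T Pbar = pairGram (Fin n) := by
      rw [hT, hPA, Matrix.mul_nonsing_inv_cancel_right _ _ hAT,
        Matrix.nonsing_inv_mul_cancel_left _ _ hAdet]
    rw [hc, this, pairCoeff_pairGram]
  have hw : ∀ k, 0 < ∑ i, w k i ^ 2 := by
    intro k
    have h0 : w k ≠ 0 := fun h => pairVec_ne_zero (e k).1.1 (e k).1.2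
      (Matrix.mulVec_injective_of_isUnit hA (by simpa [w] using h))
    obtain ⟨i, hi⟩ := Function.ne_iff.mp h0
    exact Finset.sum_pos' (fun i _ => sq_nonneg _) ⟨i, Finset.mem_univ i, sq_pos_iff.mpr hi⟩
  have hdecomp : ∀ P : Matrix (Fin n) (Fin n) ℝ, P.IsSymm →
      P = ∑ k, c k P • Matrix.vecMulVec (w k) (w k) := by
    intro P hP
    have hsymm : (T P).IsSymm := by
      rw [hT, Matrix.IsSymm, Matrix.transpose_mul, Matrix.transpose_mul, hP.eq,
        Matrix.transpose_nonsing_inv, Matrix.transpose_nonsing_inv, Matrix.transpose_transpose,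
        mul_assoc]
    have h := congrArg (fun M => A * M * A.transpose) (sum_pairCoeff_smul_vecMulVec hsymm)
    simp only [Finset.mul_sum, Finset.sum_mul, Matrix.mul_smul, Matrix.smul_mul,
      Matrix.mul_vecMulVec_mul_transpose, hT] at h
    rw [Matrix.mul_nonsing_inv_cancel_left _ _ hAdet,
      Matrix.nonsing_inv_mul_cancel_right _ _ hAT, ← e.sum_comp] at h
    exact h.symm
  have hev : ∀ᶠ P in nhds Pbar, ∀ k, 0 < c k P := by
    rw [Filter.eventually_all]
    intro k
    exact (c k).continuous.continuousAt.eventually_const_lt (by rw [hbar]; exact one_pos)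
  obtain ⟨r, hr, hball⟩ := Metric.eventually_nhds_iff.mp hev
  have hpos : ∀ P : Matrix (Fin n) (Fin n) ℝ, ‖P - Pbar‖ < r → ∀ k, 0 < c k P :=
    fun P hP => hball (by rwa [dist_eq_norm])
  refine ⟨r, hr, fun k => (√(∑ i, w k i ^ 2))⁻¹ • w k,
    fun k P => √((∑ i, w k i ^ 2) * c k P), fun k => ?_, fun k => ?_, fun P hP hPr => ?_⟩
  · simp only [Pi.smul_apply, smul_eq_mul, mul_pow, ← Finset.mul_sum, inv_pow,
      Real.sq_sqrt (hw k).le]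
    exact inv_mul_cancel₀ (hw k).ne'
  · exact ContDiffOn.sqrt (contDiff_const.mul (c k).contDiff).contDiffOn
      fun P hP => (mul_pos (hw k) (hpos P hP.2 k)).ne'
  · conv_lhs => rw [hdecomp P (by simpa using hP.isHermitian)]
    refine Finset.sum_congr rfl fun k _ => ?_
    rw [Matrix.smul_vecMulVec, Matrix.vecMulVec_smul, smul_smul, smul_smul,
      Real.sq_sqrt (mul_pos (hw k) (hpos P hPr k)).le]
    congr 1
    have h1 := Real.mul_self_sqrt (hw k).le
    have h2 := (Real.sqrt_pos.mpr (hw k)).ne'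
    rw [mul_assoc, ← mul_inv, h1, mul_comm, ← mul_assoc, inv_mul_cancel₀ (hw k).ne', one_mul]
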